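/- Let d ≥ 2, s ∈ (0,1), p ∈ (1,∞) with sp ≠ 1. There exists a constant C depending only on d, s, p (and on the unit ball B₁(0)) such that for any r > 0, any x₀ ∈ ℝ^d, and any u ∈ [C¹_c(B_r(x₀))]^d, one has ∫_{B_r(x₀)} ∫_{B_r(x₀)} |u(x)−u(y)|^p / |x−y|^{d+sp} dy dx ≤ C ∫_{B_r(x₀)} ∫_{B_r(x₀)} |(u(x)−u(y))·(x−y)/|x−y||^p / |x−y|^{d+sp} dy dx + (C / r^{sp}) ∫_{B_r(x₀)} |u(x)|^p dx. -/

import Mathlib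

open MeasureTheory ENNReal Metric
open scoped RealInnerProductSpace

noncomputable section

/-- The `p`-th power of the Gagliardo `W^{s,p}` seminorm of `u` over `Ω ⊆ ℝ^d`:
`∫_Ω ∫_Ω ‖u x - u y‖^p / ‖x - y‖^(d + s p) dy dx`. -/
def gagliardoP (d : ℕ) (s p : ℝ) (Ω : Set (EuclideanSpace ℝ (Fin d)))
    (u : EuclideanSpace ℝ (Fin d) → EuclideanSpace ℝ (Fin d)) : ℝ≥0∞ :=
  ∫⁻ x in Ω, ∫⁻ y in Ω, ENNReal.ofReal (‖u x - u y‖ ^ p / ‖x - y‖ ^ ((d : ℝ) + s * p))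

/-- The Gagliardo `W^{s,p}` seminorm `|u|_{W^{s,p}(Ω)}`. -/
def gagliardoSemi (d : ℕ) (s p : ℝ) (Ω : Set (EuclideanSpace ℝ (Fin d)))
    (u : EuclideanSpace ℝ (Fin d) → EuclideanSpace ℝ (Fin d)) : ℝ≥0∞ :=
  gagliardoP d s p Ω u ^ (1 / p)

/-- The `p`-th power of the projected-difference seminorm `[u]_{X^{s,p}(Ω)}^p`:
`∫_Ω ∫_Ω |(u x - u y) ⬝ (x-y)/‖x-y‖|^p / ‖x - y‖^(d + s p) dy dx`. -/
def projP (d : ℕ) (s p : ℝ) (Ω : Set (EuclideanSpace ℝ (Fin d)))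
    (u : EuclideanSpace ℝ (Fin d) → EuclideanSpace ℝ (Fin d)) : ℝ≥0∞ :=
  ∫⁻ x in Ω, ∫⁻ y in Ω,
    ENNReal.ofReal ((|(⟪u x - u y, x - y⟫) / ‖x - y‖|) ^ p / ‖x - y‖ ^ ((d : ℝ) + s * p))

/-- The projected-difference seminorm `[u]_{X^{s,p}(Ω)}`. -/
def projSemi (d : ℕ) (s p : ℝ) (Ω : Set (EuclideanSpace ℝ (Fin d)))
    (u : EuclideanSpace ℝ (Fin d) → EuclideanSpace ℝ (Fin d)) : ℝ≥0∞ :=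
  projP d s p Ω u ^ (1 / p)

/-- The `p`-th power of the `L^p(Ω)` norm of `u`. -/
def lpP (d : ℕ) (p : ℝ) (Ω : Set (EuclideanSpace ℝ (Fin d)))
    (u : EuclideanSpace ℝ (Fin d) → EuclideanSpace ℝ (Fin d)) : ℝ≥0∞ :=
  ∫⁻ x in Ω, ENNReal.ofReal (‖u x‖ ^ p)

/-- The `L^p(Ω)` norm of `u`. -/
def lpNorm (d : ℕ) (p : ℝ) (Ω : Set (EuclideanSpace ℝ (Fin d)))
    (u : EuclideanSpace ℝ (Fin d) → EuclideanSpace ℝ (Fin d)) : ℝ≥0∞ :=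
  lpP d p Ω u ^ (1 / p)

/-- `u` is a continuously differentiable vector field with compact support contained in `Ω`. -/
def C1c (d : ℕ) (Ω : Set (EuclideanSpace ℝ (Fin d)))
    (u : EuclideanSpace ℝ (Fin d) → EuclideanSpace ℝ (Fin d)) : Prop :=
  ContDiff ℝ 1 u ∧ HasCompactSupport u ∧ tsupport u ⊆ Ω


namespace KornAux

open Module

/-- The radial weight `‖h‖^(-q)`. -/
def wt {d : ℕ} (q : ℝ) (h : EuclideanSpace ℝ (Fin d)) : ℝ≥0∞ := ENNReal.ofReal (‖h‖ ^ (-q))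

lemma measurable_wt {d : ℕ} (q : ℝ) : Measurable (wt (d := d) q) := by
  unfold wt; fun_prop

lemma lintegral_affine {d : ℕ} (f : EuclideanSpace ℝ (Fin d) → ℝ≥0∞) (hf : Measurable f)
    (a : ℝ) (ha : 0 < a) (b : EuclideanSpace ℝ (Fin d)) :
    ∫⁻ x, f (a • x + b) = ENNReal.ofReal ((a ^ d)⁻¹) * ∫⁻ x, f x := by
  have h1 : ∫⁻ x, f (a • x + b) = ∫⁻ y, f (y + b) ∂(Measure.map (a • ·) volume) := by
    rw [lintegral_map (by fun_prop) (by fun_prop)]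
  rw [h1, Measure.map_addHaar_smul _ ha.ne', lintegral_smul_measure,
    lintegral_add_right_eq_self f b, finrank_euclideanSpace_fin, abs_of_pos (by positivity)]
  rfl

lemma tail {d : ℕ} (Q : ℝ) (hQ : (d : ℝ) < Q) : ∃ C : ℝ≥0∞, C ≠ ⊤ ∧ ∀ ρ : ℝ, 0 < ρ →
    ∫⁻ h : EuclideanSpace ℝ (Fin d) in {h | ρ ≤ ‖h‖}, wt Q h ≤ C * ENNReal.ofReal (ρ ^ ((d:ℝ) - Q)) := by
  have hfin := finite_integral_one_add_norm (E := EuclideanSpace ℝ (Fin d)) (μ := volume) (r := Q)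
    (by rw [finrank_euclideanSpace_fin]; exact hQ)
  have hQ0 : 0 < Q := lt_of_le_of_lt (Nat.cast_nonneg d) hQ
  refine ⟨ENNReal.ofReal (2 ^ Q) * _, ENNReal.mul_ne_top ENNReal.ofReal_ne_top hfin.ne, ?_⟩
  intro ρ hρ
  set F : EuclideanSpace ℝ (Fin d) → ℝ≥0∞ := fun x => ENNReal.ofReal ((1 + ‖x‖) ^ (-Q)) with hF
  have hFm : Measurable F := by fun_prop
  have hsc := lintegral_affine F hFm ρ⁻¹ (by positivity) 0
  have hms : MeasurableSet {h : EuclideanSpace ℝ (Fin d) | ρ ≤ ‖h‖} :=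
    measurableSet_le measurable_const measurable_norm
  calc ∫⁻ h : EuclideanSpace ℝ (Fin d) in {h | ρ ≤ ‖h‖}, wt Q h
      ≤ ∫⁻ h : EuclideanSpace ℝ (Fin d) in {h | ρ ≤ ‖h‖},
          ENNReal.ofReal (2 ^ Q * ρ ^ (-Q)) * F (ρ⁻¹ • h + 0) := by
        refine setLIntegral_mono' hms ?_
        intro h hh
        have hh' : ρ ≤ ‖h‖ := hh
        simp only [hF, wt, add_zero]
        rw [← ENNReal.ofReal_mul (by positivity)]
        apply ENNReal.ofReal_le_ofReal
        rw [norm_smul, Real.norm_of_nonneg (by positivity)]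
        have e1 : (2:ℝ) ^ Q = (2⁻¹ : ℝ) ^ (-Q) := by
          rw [Real.inv_rpow (by norm_num), Real.rpow_neg (by norm_num), inv_inv]
        rw [e1, ← Real.mul_rpow (by norm_num) hρ.le, ← Real.mul_rpow (by positivity) (by positivity)]
        apply Real.rpow_le_rpow_of_nonpos (by positivity) _ (by linarith)
        have : 2⁻¹ * ρ * (1 + ρ⁻¹ * ‖h‖) = (ρ + ‖h‖) / 2 := by field_simp
        rw [this]; linarith
    _ ≤ ∫⁻ h : EuclideanSpace ℝ (Fin d), ENNReal.ofReal (2 ^ Q * ρ ^ (-Q)) * F (ρ⁻¹ • h + 0) :=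
        setLIntegral_le_lintegral _ _
    _ = ENNReal.ofReal (2 ^ Q * ρ ^ (-Q)) * (ENNReal.ofReal (((ρ⁻¹) ^ d)⁻¹) * ∫⁻ x, F x) := by
        rw [lintegral_const_mul _ (by fun_prop), hsc]
    _ = ENNReal.ofReal (2 ^ Q) * (∫⁻ x, F x) * ENNReal.ofReal (ρ ^ ((d:ℝ) - Q)) := by
        rw [ENNReal.ofReal_mul (by positivity), sub_eq_add_neg, Real.rpow_add hρ,
          ENNReal.ofReal_mul (by positivity), Real.rpow_natCast, inv_pow, inv_inv]
        ring

/-- Shear change of variables for the double integral. -/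
lemma shear {d : ℕ} (Ω : Set (EuclideanSpace ℝ (Fin d))) (hΩ : MeasurableSet Ω)
    (F : EuclideanSpace ℝ (Fin d) → EuclideanSpace ℝ (Fin d) → ℝ≥0∞)
    (hF : Measurable (Function.uncurry F))
    (W : EuclideanSpace ℝ (Fin d) → ℝ≥0∞) (hW : Measurable W) :
    ∫⁻ x in Ω, ∫⁻ y in Ω, F x y * W (y - x) =
      ∫⁻ h, (∫⁻ x, (Ω ×ˢ Ω).indicator (Function.uncurry F) (x, x + h)) * W h := by
  have hi : Measurable ((Ω ×ˢ Ω).indicator (Function.uncurry F)) := hF.indicator (hΩ.prod hΩ)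
  have e1 : ∀ x, Ω.indicator (fun x => ∫⁻ y in Ω, F x y * W (y - x)) x =
      ∫⁻ h, (Ω ×ˢ Ω).indicator (Function.uncurry F) (x, x + h) * W h := by
    intro x
    have := lintegral_add_left_eq_self (μ := (volume : Measure (EuclideanSpace ℝ (Fin d))))
      (fun y => (Ω ×ˢ Ω).indicator (Function.uncurry F) (x, y) * W (y - x)) x
    simp only [add_sub_cancel_left] at this
    rw [this]
    by_cases hx : x ∈ Ω
    · rw [Set.indicator_of_mem hx, ← lintegral_indicator hΩ]
      congr 1; ext y
      by_cases hy : y ∈ Ω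
      · simp [hx, hy]
      · simp [hy]
    · simp [hx]
  rw [← lintegral_indicator hΩ]
  simp_rw [e1]
  rw [lintegral_lintegral_swap]
  · congr 1; ext h
    rw [lintegral_mul_const]
    exact hi.comp (by fun_prop)
  · apply Measurable.aemeasurable
    apply Measurable.mul (f := fun z : EuclideanSpace ℝ (Fin d) × EuclideanSpace ℝ (Fin d) =>
      (Ω ×ˢ Ω).indicator (Function.uncurry F) (z.1, z.1 + z.2))
    · exact hi.comp (by fun_prop)
    · exact hW.comp measurable_snd

lemma tonelli_part {d : ℕ} (q : ℝ) (hq : 0 < q) : ∃ C : ℝ≥0∞, C ≠ ⊤ ∧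
    ∀ B : EuclideanSpace ℝ (Fin d) → ℝ≥0∞, Measurable B → B 0 = 0 →
      ∫⁻ h : EuclideanSpace ℝ (Fin d), wt (q + d) h * ∫⁻ k in closedBall 0 (5 * ‖h‖), B k ≤ C * ∫⁻ k, B k * wt q k := by
  obtain ⟨C, hC, ht⟩ := tail (d := d) (q + d) (by linarith)
  refine ⟨C * ENNReal.ofReal ((5⁻¹ : ℝ) ^ (-q)), ENNReal.mul_ne_top hC ENNReal.ofReal_ne_top, ?_⟩
  intro B hB hB0
  set S : Set (EuclideanSpace ℝ (Fin d) × EuclideanSpace ℝ (Fin d)) := {z | ‖z.2‖ ≤ 5 * ‖z.1‖} with hS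
  have hSm : MeasurableSet S := measurableSet_le (by fun_prop) (by fun_prop)
  have hJ : Measurable (S.indicator (fun z => wt (q + d) z.1 * B z.2)) :=
    (((measurable_wt _).comp measurable_fst).mul (hB.comp measurable_snd)).indicator hSm
  have e1 : ∀ h : EuclideanSpace ℝ (Fin d), wt (q + d) h * ∫⁻ k in closedBall 0 (5 * ‖h‖), B k =
      ∫⁻ k, S.indicator (fun z => wt (q + d) z.1 * B z.2) (h, k) := by
    intro h
    rw [← lintegral_const_mul _ hB, ← lintegral_indicator measurableSet_closedBall]
    congr 1; ext k
    simp [Set.indicator, hS]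
  simp_rw [e1]
  rw [lintegral_lintegral_swap (f := fun h k => S.indicator (fun z => wt (q + d) z.1 * B z.2) (h, k))
    hJ.aemeasurable]
  rw [← lintegral_const_mul _ (show Measurable (fun k => B k * wt q k) from hB.mul (measurable_wt _))]
  apply lintegral_mono
  intro k
  by_cases hk : k = 0
  · subst hk
    simp [Set.indicator, hB0]
  have hkp : 0 < ‖k‖ := norm_pos_iff.mpr hk
  have e2 : ∫⁻ h, S.indicator (fun z => wt (q + d) z.1 * B z.2) (h, k) =
      (∫⁻ h : EuclideanSpace ℝ (Fin d) in {h | 5⁻¹ * ‖k‖ ≤ ‖h‖}, wt (q + d) h) * B k := by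
    rw [← lintegral_mul_const _ (measurable_wt _),
      ← lintegral_indicator (measurableSet_le measurable_const measurable_norm)]
    congr 1; ext h
    have : (‖k‖ ≤ 5 * ‖h‖) ↔ (5⁻¹ * ‖k‖ ≤ ‖h‖) := by constructor <;> intro _ <;> linarith
    simp [Set.indicator, hS, this]
  simp only [e2]
  calc _ ≤ (C * ENNReal.ofReal ((5⁻¹ * ‖k‖) ^ ((d:ℝ) - (q + d)))) * B k := by
        gcongr; exact ht _ (by positivity)
    _ = _ := by
        have : (d:ℝ) - (q + d) = -q := by ring
        rw [this, Real.mul_rpow (by norm_num) hkp.le, ENNReal.ofReal_mul (by positivity), wt]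
        ring

lemma absorb_num (X θ R : ℝ≥0∞) (hX : X ≠ ⊤) (hθ : θ < 1) (h : X ≤ θ * X + R) :
    X ≤ (1 - θ)⁻¹ * R := by
  have h1 : (1 - θ) * X ≤ R := by
    rw [ENNReal.sub_mul (fun _ _ => hX), one_mul]
    exact tsub_le_iff_left.mpr h
  have h0 : 1 - θ ≠ 0 := (tsub_pos_of_lt hθ).ne'
  have ht : 1 - θ ≠ ⊤ := (lt_of_le_of_lt tsub_le_self ENNReal.one_lt_top).ne
  calc X = (1 - θ)⁻¹ * ((1 - θ) * X) := by
        rw [← mul_assoc, ENNReal.inv_mul_cancel h0 ht, one_mul]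
    _ ≤ _ := by gcongr

lemma doubling {d : ℕ} (σ : ℝ) (A : EuclideanSpace ℝ (Fin d) → ℝ≥0∞) (hA : Measurable A)
    (ε : ℝ) (hε : 0 < ε) :
    ∫⁻ h in {h | ε ≤ ‖h‖}, A ((2:ℝ) • h) * wt (d + σ) h ≤
      ENNReal.ofReal (2 ^ σ) * ∫⁻ h in {h | ε ≤ ‖h‖}, A h * wt (d + σ) h := by
  have hms : ∀ ρ : ℝ, MeasurableSet {h : EuclideanSpace ℝ (Fin d) | ρ ≤ ‖h‖} := fun ρ =>
    measurableSet_le measurable_const measurable_norm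
  set f : EuclideanSpace ℝ (Fin d) → ℝ≥0∞ :=
    {h : EuclideanSpace ℝ (Fin d) | ε ≤ ‖h‖}.indicator (fun h => A h * wt (d + σ) h) with hf
  have hfm : Measurable f := (hA.mul (measurable_wt _)).indicator (hms _)
  rw [← lintegral_indicator (hms ε), ← lintegral_indicator (hms ε)]
  calc _ ≤ ∫⁻ h, ENNReal.ofReal (2 ^ ((d:ℝ) + σ)) * f ((2:ℝ) • h + 0) := by
        apply lintegral_mono
        intro h
        by_cases hh : ε ≤ ‖h‖
        · have h2 : ε ≤ ‖(2:ℝ) • h‖ := by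
            rw [norm_smul, Real.norm_of_nonneg (by norm_num)]; linarith
          beta_reduce
          rw [Set.indicator_of_mem (by exact hh), add_zero, hf, Set.indicator_of_mem (by exact h2)]
          apply le_of_eq
          unfold wt
          rw [norm_smul, Real.norm_of_nonneg (by norm_num), Real.mul_rpow (by norm_num) (norm_nonneg _),
            ENNReal.ofReal_mul (by positivity), mul_left_comm, ← mul_assoc (ENNReal.ofReal _)
            (ENNReal.ofReal _) (ENNReal.ofReal _), ← ENNReal.ofReal_mul (by positivity),
            ← Real.rpow_add (by norm_num)]
          simp
        · rw [Set.indicator_of_notMem (by exact hh)]; exact zero_le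
    _ = ENNReal.ofReal (2 ^ ((d:ℝ) + σ)) * (ENNReal.ofReal (((2:ℝ) ^ d)⁻¹) * ∫⁻ h, f h) := by
        rw [lintegral_const_mul _ (by fun_prop), lintegral_affine f hfm 2 (by norm_num) 0]
    _ = _ := by
        rw [← mul_assoc, ← ENNReal.ofReal_mul (by positivity), Real.rpow_add (by norm_num),
          Real.rpow_natCast]
        congr 2
        field_simp

lemma absorb {d : ℕ} (σ : ℝ) (hσ : 0 < σ) : ∃ CT : ℝ≥0∞, CT ≠ ⊤ ∧
    ∀ (A B : EuclideanSpace ℝ (Fin d) → ℝ≥0∞), Measurable A → Measurable B → A 0 = 0 → B 0 = 0 →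
    ∀ (ρ : ℝ) (c K θ : ℝ≥0∞), 0 < ρ → c * ENNReal.ofReal (2 ^ σ) ≤ θ → θ < 1 →
    (∀ h, 0 < ‖h‖ → ‖h‖ < ρ → A h ≤ c * A ((2:ℝ) • h) +
      K * (wt d h * ∫⁻ k in closedBall 0 (5 * ‖h‖), B k)) →
    ∫⁻ h, A h ≠ ⊤ →
    ∫⁻ h, A h * wt (d + σ) h ≤ (1 - θ)⁻¹ * (K * (CT * ∫⁻ k, B k * wt (d + σ) k) +
      ENNReal.ofReal (ρ ^ (-(d + σ))) * ∫⁻ h, A h) := by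
  obtain ⟨CT, hCT, hton⟩ := tonelli_part (d := d) (d + σ) (by positivity)
  refine ⟨CT, hCT, ?_⟩
  intro A B hA hB hA0 hB0 ρ c K θ hρ hc hθ hI hM
  set q : ℝ := d + σ with hq
  have hq0 : 0 < q := by positivity
  have hms : ∀ ρ : ℝ, MeasurableSet {h : EuclideanSpace ℝ (Fin d) | ρ ≤ ‖h‖} := fun ρ =>
    measurableSet_le measurable_const measurable_norm
  have hwle : ∀ (ε : ℝ), 0 < ε → ∀ h : EuclideanSpace ℝ (Fin d), ε ≤ ‖h‖ →
      wt q h ≤ ENNReal.ofReal (ε ^ (-q)) := by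
    intro ε hε h hh
    apply ENNReal.ofReal_le_ofReal
    exact Real.rpow_le_rpow_of_nonpos hε hh (by linarith)
  set R : ℝ≥0∞ := K * (CT * ∫⁻ k, B k * wt q k) + ENNReal.ofReal (ρ ^ (-q)) * ∫⁻ h, A h with hR
  have hIB : Measurable (fun h : EuclideanSpace ℝ (Fin d) =>
      ∫⁻ k in closedBall 0 (5 * ‖h‖), B k) := by
    have : (fun h : EuclideanSpace ℝ (Fin d) => ∫⁻ k in closedBall 0 (5 * ‖h‖), B k) =
        (fun t : ℝ => ∫⁻ k in closedBall (0 : EuclideanSpace ℝ (Fin d)) t, B k) ∘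
          (fun h => 5 * ‖h‖) := rfl
    rw [this]
    apply Measurable.comp _ (by fun_prop)
    apply Monotone.measurable
    intro a b hab
    exact lintegral_mono_set (closedBall_subset_closedBall hab)
  have key : ∀ ε : ℝ, 0 < ε → ∫⁻ h in {h | ε ≤ ‖h‖}, A h * wt q h ≤ (1 - θ)⁻¹ * R := by
    intro ε hε
    apply absorb_num _ _ _ _ hθ
    · calc ∫⁻ h in {h | ε ≤ ‖h‖}, A h * wt q h
          ≤ ∫⁻ h, c * (A ((2:ℝ) • h)  * {h : EuclideanSpace ℝ (Fin d) | ε ≤ ‖h‖}.indicator (wt q) h)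
              + K * (wt (q + d) h * ∫⁻ k in closedBall 0 (5 * ‖h‖), B k) +
              ENNReal.ofReal (ρ ^ (-q)) * A h := by
            rw [← lintegral_indicator (hms ε)]
            apply lintegral_mono
            intro h
            by_cases hh : ε ≤ ‖h‖
            swap
            · rw [Set.indicator_of_notMem (by exact hh)]; exact zero_le
            have hpos : 0 < ‖h‖ := hε.trans_le hh
            simp only [Set.indicator_of_mem (show h ∈ {h : EuclideanSpace ℝ (Fin d) | ε ≤ ‖h‖} from hh)]
            by_cases h2 : ‖h‖ < ρ
            · refine le_add_right ?_
              have ew : wt (q + d) h = wt d h * wt q h := by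
                unfold wt
                rw [← ENNReal.ofReal_mul (by positivity), ← Real.rpow_add hpos]
                congr 2; ring
              calc A h * wt q h ≤ (c * A ((2:ℝ) • h) +
                    K * (wt d h * ∫⁻ k in closedBall 0 (5 * ‖h‖), B k)) * wt q h := by
                    gcongr; exact hI h hpos h2
                _ = _ := by rw [ew]; ring
            · refine le_add_left ?_
              rw [mul_comm]
              gcongr
              exact hwle ρ hρ h (not_lt.mp h2)
        _ = c * (∫⁻ h in {h | ε ≤ ‖h‖}, A ((2:ℝ) • h) * wt q h) +
            K * (∫⁻ h, wt (q + d) h * ∫⁻ k in closedBall 0 (5 * ‖h‖), B k) +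
            ENNReal.ofReal (ρ ^ (-q)) * ∫⁻ h, A h := by
            have m1 : Measurable (fun h : EuclideanSpace ℝ (Fin d) => A ((2:ℝ) • h) *
                {h : EuclideanSpace ℝ (Fin d) | ε ≤ ‖h‖}.indicator (wt q) h) :=
              (hA.comp (by fun_prop)).mul ((measurable_wt q).indicator (hms ε))
            have m2 : Measurable (fun h : EuclideanSpace ℝ (Fin d) =>
                wt (q + d) h * ∫⁻ k in closedBall 0 (5 * ‖h‖), B k) := (measurable_wt _).mul hIB
            rw [lintegral_add_right _ (hA.const_mul _), lintegral_add_left (m1.const_mul _),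
              lintegral_const_mul _ m1, lintegral_const_mul _ m2, lintegral_const_mul _ hA,
              ← lintegral_indicator (hms ε)]
            congr 4
            ext h
            by_cases hh : ε ≤ ‖h‖ <;> simp [Set.indicator, hh]
        _ ≤ c * (ENNReal.ofReal (2 ^ σ) * ∫⁻ h in {h | ε ≤ ‖h‖}, A h * wt q h) +
            K * (CT * ∫⁻ k, B k * wt q k) + ENNReal.ofReal (ρ ^ (-q)) * ∫⁻ h, A h := by
            gcongr
            · exact doubling σ A hA ε hε
            · exact hton B hB hB0
        _ ≤ _ := by
            rw [hR, ← mul_assoc, add_assoc]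
            gcongr
    · apply ne_of_lt
      calc ∫⁻ h in {h | ε ≤ ‖h‖}, A h * wt q h
          ≤ ∫⁻ h in {h | ε ≤ ‖h‖}, A h * ENNReal.ofReal (ε ^ (-q)) := by
            refine setLIntegral_mono' (hms ε) ?_
            intro h hh
            gcongr
            exact hwle ε hε h hh
        _ ≤ ∫⁻ h, A h * ENNReal.ofReal (ε ^ (-q)) := setLIntegral_le_lintegral _ _
        _ = (∫⁻ h, A h) * ENNReal.ofReal (ε ^ (-q)) := lintegral_mul_const _ hA
        _ < ⊤ := ENNReal.mul_lt_top hM.lt_top ENNReal.ofReal_lt_top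
  set S : ℕ → Set (EuclideanSpace ℝ (Fin d)) := fun n => {h | 1 / ((n:ℝ) + 1) ≤ ‖h‖} with hS
  have hU : ∫⁻ h, A h * wt q h = ∫⁻ h in ⋃ n, S n, A h * wt q h := by
    rw [← lintegral_indicator (MeasurableSet.iUnion (fun n => hms _))]
    congr 1; ext h
    by_cases hh : h = 0
    · subst hh
      simp [Set.indicator, hA0]
    · rw [Set.indicator_of_mem]
      obtain ⟨n, hn⟩ := exists_nat_one_div_lt (norm_pos_iff.mpr hh)
      exact Set.mem_iUnion.mpr ⟨n, hn.le⟩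
  rw [hU, setLIntegral_iUnion_of_directed]
  · exact iSup_le fun n => key _ (by positivity)
  · apply Monotone.directed_le
    intro m n hmn h hh
    have hh' : 1 / ((m:ℝ) + 1) ≤ ‖h‖ := hh
    exact le_trans (Nat.one_div_le_one_div hmn) hh'

/-- Absolute value of the projected difference. -/
def pr {d : ℕ} (u : EuclideanSpace ℝ (Fin d) → EuclideanSpace ℝ (Fin d))
    (z w : EuclideanSpace ℝ (Fin d)) : ℝ := |⟪u z - u w, z - w⟫ / ‖z - w‖|

lemma pr_nonneg {d : ℕ} (u : EuclideanSpace ℝ (Fin d) → EuclideanSpace ℝ (Fin d))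
    (z w : EuclideanSpace ℝ (Fin d)) : 0 ≤ pr u z w := abs_nonneg _

lemma abs_inner_eq {d : ℕ} (u : EuclideanSpace ℝ (Fin d) → EuclideanSpace ℝ (Fin d))
    (z w : EuclideanSpace ℝ (Fin d)) : |⟪u z - u w, z - w⟫| = ‖z - w‖ * pr u z w := by
  unfold pr
  by_cases h : ‖z - w‖ = 0
  · have : z - w = 0 := norm_eq_zero.mp h
    rw [h, this]; simp
  · rw [abs_div, abs_norm]; field_simp

/-- Projected differences to a common point, restricted to `Ω × Ω`. -/
def kk {d : ℕ} (p : ℝ) (Ω : Set (EuclideanSpace ℝ (Fin d)))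
    (u : EuclideanSpace ℝ (Fin d) → EuclideanSpace ℝ (Fin d)) :
    EuclideanSpace ℝ (Fin d) × EuclideanSpace ℝ (Fin d) → ℝ≥0∞ :=
  (Ω ×ˢ Ω).indicator (Function.uncurry fun z w => ENNReal.ofReal (pr u z w ^ p))

/-- Local projected energy at the point `z` and scale `τ`. -/
def Phi {d : ℕ} (p : ℝ) (Ω : Set (EuclideanSpace ℝ (Fin d)))
    (u : EuclideanSpace ℝ (Fin d) → EuclideanSpace ℝ (Fin d)) (τ : ℝ)
    (z : EuclideanSpace ℝ (Fin d)) : ℝ≥0∞ :=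
  ∫⁻ k in closedBall 0 τ, kk p Ω u (z, z + k)

lemma measurable_pr {d : ℕ} (p : ℝ) (u : EuclideanSpace ℝ (Fin d) → EuclideanSpace ℝ (Fin d))
    (hu : Measurable u) :
    Measurable (Function.uncurry fun z w => ENNReal.ofReal (pr u z w ^ p)) := by
  unfold pr Function.uncurry
  have h1 : Measurable fun a : EuclideanSpace ℝ (Fin d) × EuclideanSpace ℝ (Fin d) => u a.1 :=
    hu.comp measurable_fst
  have h2 : Measurable fun a : EuclideanSpace ℝ (Fin d) × EuclideanSpace ℝ (Fin d) => u a.2 :=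
    hu.comp measurable_snd
  have h3 : Measurable fun a : EuclideanSpace ℝ (Fin d) × EuclideanSpace ℝ (Fin d) =>
      (⟪u a.1 - u a.2, a.1 - a.2⟫ : ℝ) := (h1.sub h2).inner (by fun_prop)
  have h4 : Measurable fun a : EuclideanSpace ℝ (Fin d) × EuclideanSpace ℝ (Fin d) =>
      |(⟪u a.1 - u a.2, a.1 - a.2⟫ : ℝ) / ‖a.1 - a.2‖| := by
    exact continuous_abs.measurable.comp (h3.div (by fun_prop))
  exact (h4.pow_const p).ennreal_ofReal

lemma measurable_kk {d : ℕ} (p : ℝ) (Ω : Set (EuclideanSpace ℝ (Fin d))) (hΩ : MeasurableSet Ω)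
    (u : EuclideanSpace ℝ (Fin d) → EuclideanSpace ℝ (Fin d)) (hu : Measurable u) :
    Measurable (kk p Ω u) :=
  (measurable_pr p u hu).indicator (hΩ.prod hΩ)

lemma measurable_Phi {d : ℕ} (p : ℝ) (Ω : Set (EuclideanSpace ℝ (Fin d))) (hΩ : MeasurableSet Ω)
    (u : EuclideanSpace ℝ (Fin d) → EuclideanSpace ℝ (Fin d)) (hu : Measurable u) (τ : ℝ) :
    Measurable (Phi p Ω u τ) := by
  unfold Phi
  apply Measurable.lintegral_prod_right'
    (f := fun a : EuclideanSpace ℝ (Fin d) × EuclideanSpace ℝ (Fin d) => kk p Ω u (a.1, a.1 + a.2))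
  exact (measurable_kk p Ω hΩ u hu).comp (by fun_prop)

lemma lintegral_Phi {d : ℕ} (p : ℝ) (Ω : Set (EuclideanSpace ℝ (Fin d))) (hΩ : MeasurableSet Ω)
    (u : EuclideanSpace ℝ (Fin d) → EuclideanSpace ℝ (Fin d)) (hu : Measurable u) (τ : ℝ) :
    ∫⁻ z, Phi p Ω u τ z = ∫⁻ k in closedBall 0 τ, ∫⁻ z, kk p Ω u (z, z + k) := by
  unfold Phi
  apply lintegral_lintegral_swap
  exact ((measurable_kk p Ω hΩ u hu).comp
    (g := kk p Ω u) (f := fun a : EuclideanSpace ℝ (Fin d) × EuclideanSpace ℝ (Fin d) =>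
      (a.1, a.1 + a.2)) (by fun_prop)).aemeasurable

/-- The local energy dominates the integral of projected differences over a ball. -/
lemma le_Phi {d : ℕ} (p : ℝ) (Ω : Set (EuclideanSpace ℝ (Fin d)))
    (u : EuclideanSpace ℝ (Fin d) → EuclideanSpace ℝ (Fin d)) (τ : ℝ)
    (z : EuclideanSpace ℝ (Fin d)) (hz : z ∈ Ω) (S : Set (EuclideanSpace ℝ (Fin d)))
    (hSm : MeasurableSet S) (hS : S ⊆ Ω) (hd : ∀ w ∈ S, ‖w - z‖ ≤ τ) :
    ∫⁻ w in S, ENNReal.ofReal (pr u z w ^ p) ≤ Phi p Ω u τ z := by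
  have h1 : Phi p Ω u τ z = ∫⁻ w, (closedBall 0 τ).indicator (fun k => kk p Ω u (z, z + k)) (w - z) := by
    rw [lintegral_sub_right_eq_self (fun k => (closedBall 0 τ).indicator
      (fun k => kk p Ω u (z, z + k)) k), lintegral_indicator measurableSet_closedBall]
    rfl
  rw [h1, ← lintegral_indicator hSm]
  apply lintegral_mono
  intro w
  by_cases hw : w ∈ S
  · have h2 : w - z ∈ closedBall (0 : EuclideanSpace ℝ (Fin d)) τ := by simpa using hd w hw
    simp only [Set.indicator_of_mem hw, Set.indicator_of_mem h2, kk, add_sub_cancel]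
    rw [Set.indicator_of_mem (show (z, w) ∈ Ω ×ˢ Ω from ⟨hz, hS hw⟩)]
    rfl
  · simp [hw]

/-- Key algebraic identity: affine-annihilating combinations of `u` are combinations of
projected differences. -/
lemma key_identity {d : ℕ} (u : EuclideanSpace ℝ (Fin d) → EuclideanSpace ℝ (Fin d))
    (c : Fin 4 → ℝ) (z : Fin 4 → EuclideanSpace ℝ (Fin d)) (hc : ∑ j, c j = 0)
    (hcz : ∑ j, c j • z j = 0) (w w' : EuclideanSpace ℝ (Fin d)) :
    ⟪∑ j, c j • u (z j), w' - w⟫ =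
      ∑ j, c j * (⟪u (z j) - u w, z j - w⟫ - ⟪u (z j) - u w', z j - w'⟫) := by
  have h1 : ∀ v : EuclideanSpace ℝ (Fin d), ∑ j, c j * ⟪u (z j) - u v, z j - v⟫ =
      ∑ j, c j * ⟪u (z j), z j⟫ - ⟪∑ j, c j • u (z j), v⟫ := by
    intro v
    have a1 : ∑ j, c j * ⟪u v, z j⟫ = (0 : ℝ) := by
      have : ⟪u v, ∑ j, c j • z j⟫ = (0 : ℝ) := by rw [hcz, inner_zero_right]
      rw [inner_sum] at this
      simpa [inner_smul_right] using this
    have a2 : ∑ j, c j * ⟪u v, v⟫ = (0 : ℝ) := by rw [← Finset.sum_mul, hc, zero_mul]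
    have a3 : (⟪∑ j, c j • u (z j), v⟫ : ℝ) = ∑ j, c j * ⟪u (z j), v⟫ := by
      rw [sum_inner]; simp [inner_smul_left]
    rw [a3, ← Finset.sum_sub_distrib]
    have : ∀ j, c j * ⟪u (z j) - u v, z j - v⟫ = (c j * ⟪u (z j), z j⟫ - c j * ⟪u (z j), v⟫)
        - c j * ⟪u v, z j⟫ + c j * ⟪u v, v⟫ := by
      intro j
      rw [inner_sub_left, inner_sub_right, inner_sub_right]; ring
    simp_rw [this]
    rw [Finset.sum_add_distrib, Finset.sum_sub_distrib, a1, a2]; ring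
  simp_rw [mul_sub]
  rw [Finset.sum_sub_distrib, h1 w, h1 w', inner_sub_right]; ring

lemma T_bound {d : ℕ} (p : ℝ) (hp : 1 < p) (u : EuclideanSpace ℝ (Fin d) → EuclideanSpace ℝ (Fin d))
    (c : Fin 4 → ℝ) (z : Fin 4 → EuclideanSpace ℝ (Fin d)) (hc : ∑ j, c j = 0)
    (hc1 : ∀ j, |c j| ≤ 1)
    (hcz : ∑ j, c j • z j = 0) (t : ℝ) (ht : 0 < t) (w w' : EuclideanSpace ℝ (Fin d))
    (hw : w' - w = (t / ‖∑ j, c j • u (z j)‖) • ∑ j, c j • u (z j))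
    (h1 : ∀ j, ‖w - z j‖ ≤ 5 * t) (h2 : ∀ j, ‖w' - z j‖ ≤ 5 * t) :
    ‖∑ j, c j • u (z j)‖ ^ p ≤ 40 ^ p * ∑ j, (pr u (z j) w ^ p + pr u (z j) w' ^ p) := by
  set T := ∑ j, c j • u (z j) with hT
  have e1 : t * ‖T‖ = ⟪T, w' - w⟫ := by
    rw [hw, inner_smul_right, real_inner_self_eq_norm_sq]
    by_cases h : ‖T‖ = 0
    · simp [h]
    · field_simp
  have e2 := key_identity u c z hc hcz w w'
  set M : ℝ := (∑ j, (pr u (z j) w ^ p + pr u (z j) w' ^ p)) with hM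
  have hpn : ∀ (a b : EuclideanSpace ℝ (Fin d)), 0 ≤ pr u a b ^ p := fun a b =>
    Real.rpow_nonneg (pr_nonneg u a b) p
  have hM0 : 0 ≤ M := Finset.sum_nonneg fun j _ => add_nonneg (hpn _ _) (hpn _ _)
  have hMj : ∀ j, pr u (z j) w ^ p + pr u (z j) w' ^ p ≤ M := fun j =>
    Finset.single_le_sum (f := fun j => pr u (z j) w ^ p + pr u (z j) w' ^ p)
      (fun j _ => add_nonneg (hpn _ _) (hpn _ _)) (Finset.mem_univ j)
  have hp0 : 0 < p := by linarith
  have hroot : ∀ a : ℝ, 0 ≤ a → a ^ p ≤ M → a ≤ M ^ (1 / p) := by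
    intro a ha h
    calc a = (a ^ p) ^ (1 / p) := by rw [← Real.rpow_mul ha]; field_simp; simp
      _ ≤ _ := Real.rpow_le_rpow (by positivity) h (by positivity)
  set N := M ^ (1 / p) with hN
  have hN0 : 0 ≤ N := by positivity
  have b1 : ∀ j, pr u (z j) w ≤ N := fun j => hroot _ (pr_nonneg _ _ _)
    (by linarith [hMj j, hpn (z j) w'])
  have b2 : ∀ j, pr u (z j) w' ≤ N := fun j => hroot _ (pr_nonneg _ _ _)
    (by linarith [hMj j, hpn (z j) w])
  have e3 : t * ‖T‖ ≤ 40 * t * N := by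
    rw [e1, e2]
    calc _ ≤ ∑ j : Fin 4, (10 * t * N) := by
          apply Finset.sum_le_sum
          intro j _
          have k1 : |⟪u (z j) - u w, z j - w⟫| ≤ 5 * t * N := by
            rw [abs_inner_eq, norm_sub_rev]
            exact mul_le_mul (h1 j) (b1 j) (pr_nonneg _ _ _) (by positivity)
          have k2 : |⟪u (z j) - u w', z j - w'⟫| ≤ 5 * t * N := by
            rw [abs_inner_eq, norm_sub_rev]
            exact mul_le_mul (h2 j) (b2 j) (pr_nonneg _ _ _) (by positivity)
          refine (le_abs_self _).trans ?_
          rw [abs_mul]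
          calc _ ≤ 1 * |⟪u (z j) - u w, z j - w⟫ - ⟪u (z j) - u w', z j - w'⟫| := by
                gcongr; exact hc1 j
            _ ≤ _ := by
                rw [one_mul]
                refine (abs_sub _ _).trans ?_
                linarith
      _ = _ := by simp; ring
  have e4 : ‖T‖ ≤ 40 * N := by
    have : t * ‖T‖ ≤ t * (40 * N) := by linarith
    exact le_of_mul_le_mul_left this ht
  calc ‖T‖ ^ p ≤ (40 * N) ^ p := Real.rpow_le_rpow (norm_nonneg _) e4 hp0.le
    _ = 40 ^ p * M := by
        rw [Real.mul_rpow (by norm_num) hN0, hN, ← Real.rpow_mul hM0]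
        field_simp; simp

lemma avg_bound {d : ℕ} (p : ℝ) (hp : 1 < p) (Ω : Set (EuclideanSpace ℝ (Fin d)))
    (u : EuclideanSpace ℝ (Fin d) → EuclideanSpace ℝ (Fin d)) (hu : Measurable u)
    (c : Fin 4 → ℝ) (z : Fin 4 → EuclideanSpace ℝ (Fin d)) (hc : ∑ j, c j = 0)
    (hc1 : ∀ j, |c j| ≤ 1)
    (hcz : ∑ j, c j • z j = 0) (t : ℝ) (ht : 0 < t) (x' : EuclideanSpace ℝ (Fin d))
    (hb : ball x' (2 * t) ⊆ Ω) (hz : ∀ j, z j ∈ Ω)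
    (hdist : ∀ j, ∀ w ∈ ball x' (2 * t), ‖w - z j‖ ≤ 5 * t) :
    ENNReal.ofReal (‖∑ j, c j • u (z j)‖ ^ p) ≤
      (ENNReal.ofReal (40 ^ p) * 2 * (volume (ball (0 : EuclideanSpace ℝ (Fin d)) 1))⁻¹) *
        ENNReal.ofReal (t ^ (-(d:ℝ))) * ∑ j, Phi p Ω u (5 * t) (z j) := by
  set T := ∑ j, c j • u (z j) with hT
  set τ : EuclideanSpace ℝ (Fin d) := (t / ‖T‖) • T with hτ
  have hτn : ‖τ‖ ≤ t := by
    rw [hτ, norm_smul, Real.norm_of_nonneg (by positivity)]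
    by_cases h : ‖T‖ = 0
    · simp [h, ht.le]
    · field_simp; exact le_rfl
  set f : Fin 4 → EuclideanSpace ℝ (Fin d) → ℝ≥0∞ := fun j w => ENNReal.ofReal (pr u (z j) w ^ p)
    with hf
  have hfm : ∀ j, Measurable (f j) := fun j => (measurable_pr p u hu).comp
    (g := Function.uncurry fun z w => ENNReal.ofReal (pr u z w ^ p)) (f := fun w => (z j, w))
    (by fun_prop)
  have hsub : ball x' t ⊆ ball x' (2 * t) := ball_subset_ball (by linarith)
  have hshift : ∀ w ∈ ball x' t, w + τ ∈ ball x' (2 * t) := by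
    intro w hw
    rw [mem_ball, dist_eq_norm] at *
    calc ‖w + τ - x'‖ = ‖(w - x') + τ‖ := by congr 1; abel
      _ ≤ ‖w - x'‖ + ‖τ‖ := norm_add_le _ _
      _ < _ := by linarith
  have hF : ∀ j, ∫⁻ w in ball x' (2 * t), f j w ≤ Phi p Ω u (5 * t) (z j) := fun j =>
    le_Phi p Ω u (5 * t) (z j) (hz j) _ measurableSet_ball hb (hdist j)
  have hG : ∀ j, ∫⁻ w in ball x' t, f j (w + τ) ≤ ∫⁻ w in ball x' (2 * t), f j w := by
    intro j
    rw [← lintegral_indicator measurableSet_ball, ← lintegral_indicator measurableSet_ball,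
      ← lintegral_add_right_eq_self ((ball x' (2 * t)).indicator (f j)) τ]
    apply lintegral_mono
    intro w
    by_cases hw : w ∈ ball x' t
    · simp only [Set.indicator_of_mem hw, Set.indicator_of_mem (hshift w hw)]; exact le_rfl
    · simp only [Set.indicator_of_notMem hw]; exact zero_le
  have hpt : ∀ w ∈ ball x' t, ENNReal.ofReal (‖T‖ ^ p) ≤
      ENNReal.ofReal (40 ^ p) * ∑ j, (f j w + f j (w + τ)) := by
    intro w hw
    have := T_bound p hp u c z hc hc1 hcz t ht w (w + τ) (by simp [hτ, hT])
      (fun j => hdist j w (hsub hw)) (fun j => hdist j _ (hshift w hw))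
    refine (ENNReal.ofReal_le_ofReal this).trans (le_of_eq ?_)
    have hpn : ∀ (a b : EuclideanSpace ℝ (Fin d)), 0 ≤ pr u a b ^ p := fun a b =>
      Real.rpow_nonneg (pr_nonneg u a b) p
    rw [ENNReal.ofReal_mul (by positivity), ENNReal.ofReal_sum_of_nonneg
      (fun j _ => add_nonneg (hpn _ _) (hpn _ _))]
    congr 1
    apply Finset.sum_congr rfl
    intro j _
    rw [ENNReal.ofReal_add (hpn _ _) (hpn _ _)]
  have h_intg : ENNReal.ofReal (‖T‖ ^ p) * volume (ball x' t) ≤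
      ENNReal.ofReal (40 ^ p) * 2 * ∑ j, Phi p Ω u (5 * t) (z j) := by
    calc ENNReal.ofReal (‖T‖ ^ p) * volume (ball x' t)
        = ∫⁻ w in ball x' t, ENNReal.ofReal (‖T‖ ^ p) := by rw [setLIntegral_const]
      _ ≤ ∫⁻ w in ball x' t, ENNReal.ofReal (40 ^ p) * ∑ j, (f j w + f j (w + τ)) :=
          setLIntegral_mono' measurableSet_ball hpt
      _ = ENNReal.ofReal (40 ^ p) * ∑ j, ((∫⁻ w in ball x' t, f j w) +
            ∫⁻ w in ball x' t, f j (w + τ)) := by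
          have m : ∀ j, Measurable fun w => f j w + f j (w + τ) := fun j =>
            (hfm j).add ((hfm j).comp (by fun_prop))
          rw [lintegral_const_mul _ (Finset.measurable_fun_sum _ fun j _ => m j),
            lintegral_finsetSum _ (fun j _ => m j)]
          congr 1
          apply Finset.sum_congr rfl
          intro j _
          rw [lintegral_add_left (hfm j)]
      _ ≤ ENNReal.ofReal (40 ^ p) * ∑ j, (2 * Phi p Ω u (5 * t) (z j)) := by
          gcongr with j _
          rw [two_mul]
          exact add_le_add ((lintegral_mono_set hsub).trans (hF j)) ((hG j).trans (hF j))
      _ = _ := by rw [← Finset.mul_sum]; ring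
  have hvol : volume (ball x' t) = ENNReal.ofReal (t ^ d) *
      volume (ball (0 : EuclideanSpace ℝ (Fin d)) 1) := by
    rw [Measure.addHaar_ball_of_pos _ _ ht, finrank_euclideanSpace_fin]
  set V := volume (ball (0 : EuclideanSpace ℝ (Fin d)) 1) with hV
  have hV0 : V ≠ 0 := (measure_ball_pos _ _ one_pos).ne'
  have hVt : V ≠ ⊤ := measure_ball_lt_top.ne
  rw [hvol] at h_intg
  have hone : ENNReal.ofReal (t ^ d) * ENNReal.ofReal (t ^ (-(d:ℝ))) = 1 := by
    rw [← ENNReal.ofReal_mul (by positivity), Real.rpow_neg ht.le, Real.rpow_natCast,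
      mul_inv_cancel₀ (by positivity), ENNReal.ofReal_one]
  calc ENNReal.ofReal (‖T‖ ^ p) = ENNReal.ofReal (‖T‖ ^ p) *
        (ENNReal.ofReal (t ^ d) * ENNReal.ofReal (t ^ (-(d:ℝ)))) * (V * V⁻¹) := by
        rw [hone, ENNReal.mul_inv_cancel hV0 hVt, mul_one, mul_one]
    _ = (ENNReal.ofReal (‖T‖ ^ p) * (ENNReal.ofReal (t ^ d) * V)) *
          (ENNReal.ofReal (t ^ (-(d:ℝ))) * V⁻¹) := by ring
    _ ≤ (ENNReal.ofReal (40 ^ p) * 2 * ∑ j, Phi p Ω u (5 * t) (z j)) *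
          (ENNReal.ofReal (t ^ (-(d:ℝ))) * V⁻¹) := by gcongr
    _ = _ := by ring

lemma add_rpow_split (p η a b : ℝ) (hp : 0 < p) (hη : 0 < η) (ha : 0 ≤ a) (hb : 0 ≤ b) :
    (a + b) ^ p ≤ (1 + η) ^ p * a ^ p + (1 + 1 / η) ^ p * b ^ p := by
  rw [← Real.mul_rpow (by positivity) ha, ← Real.mul_rpow (by positivity) hb]
  rcases le_total b (η * a) with h | h
  · have : (a + b) ^ p ≤ ((1 + η) * a) ^ p :=
      Real.rpow_le_rpow (by positivity) (by linarith) hp.le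
    have h2 : 0 ≤ ((1 + 1 / η) * b) ^ p := by positivity
    linarith
  · have : (a + b) ^ p ≤ ((1 + 1 / η) * b) ^ p := by
      apply Real.rpow_le_rpow (by positivity) _ hp.le
      have : a ≤ 1 / η * b := by
        rw [one_div, inv_mul_eq_div, le_div_iff₀ hη]; linarith
      linarith
    have h2 : 0 ≤ ((1 + η) * a) ^ p := by positivity
    linarith

/-- Full differences restricted to `Ω × Ω`. -/
def gg {d : ℕ} (p : ℝ) (Ω : Set (EuclideanSpace ℝ (Fin d)))
    (u : EuclideanSpace ℝ (Fin d) → EuclideanSpace ℝ (Fin d)) :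
    EuclideanSpace ℝ (Fin d) × EuclideanSpace ℝ (Fin d) → ℝ≥0∞ :=
  (Ω ×ˢ Ω).indicator (Function.uncurry fun z w => ENNReal.ofReal (‖u z - u w‖ ^ p))

lemma measurable_diff {d : ℕ} (p : ℝ) (u : EuclideanSpace ℝ (Fin d) → EuclideanSpace ℝ (Fin d))
    (hu : Measurable u) :
    Measurable (Function.uncurry fun z w => ENNReal.ofReal (‖u z - u w‖ ^ p)) := by
  unfold Function.uncurry
  have h1 : Measurable fun a : EuclideanSpace ℝ (Fin d) × EuclideanSpace ℝ (Fin d) => u a.1 :=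
    hu.comp measurable_fst
  have h2 : Measurable fun a : EuclideanSpace ℝ (Fin d) × EuclideanSpace ℝ (Fin d) => u a.2 :=
    hu.comp measurable_snd
  exact ((h1.sub h2).norm.pow_const p).ennreal_ofReal

lemma measurable_gg {d : ℕ} (p : ℝ) (Ω : Set (EuclideanSpace ℝ (Fin d))) (hΩ : MeasurableSet Ω)
    (u : EuclideanSpace ℝ (Fin d) → EuclideanSpace ℝ (Fin d)) (hu : Measurable u) :
    Measurable (gg p Ω u) :=
  (measurable_diff p u hu).indicator (hΩ.prod hΩ)

/-- The constant in the pointwise estimate. -/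
def KK (d : ℕ) (p δ : ℝ) : ℝ≥0∞ := ENNReal.ofReal ((1 + 1 / δ) ^ p) *
  (ENNReal.ofReal (40 ^ p) * 2 * (volume (ball (0 : EuclideanSpace ℝ (Fin d)) 1))⁻¹)

lemma pointwise_step {d : ℕ} (p δ : ℝ) (hp : 1 < p) (hδ : 0 < δ) (hδ4 : δ ≤ 1 / 4)
    (x₀ : EuclideanSpace ℝ (Fin d)) (r : ℝ) (hr : 0 < r)
    (u : EuclideanSpace ℝ (Fin d) → EuclideanSpace ℝ (Fin d)) (hu : Measurable u)
    (h : EuclideanSpace ℝ (Fin d)) (h0 : 0 < ‖h‖) (h1 : ‖h‖ < δ * r)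
    (x : EuclideanSpace ℝ (Fin d)) (a : ℝ) (ha : a = 1 - 2 * ‖h‖ / r)
    (b : EuclideanSpace ℝ (Fin d)) (hb : b = (2 * ‖h‖ / r) • x₀) :
    gg p (ball x₀ r) u (x, x + h) ≤
      ENNReal.ofReal ((1 + δ) ^ p * 2 ^ (-p)) *
        gg p (ball x₀ r) u (a • x + b, a • x + b + (2:ℝ) • h) +
      KK d p δ * ENNReal.ofReal (‖h‖ ^ (-(d:ℝ))) *
        (Phi p (ball x₀ r) u (5 * ‖h‖) x + Phi p (ball x₀ r) u (5 * ‖h‖) (x + h) +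
          Phi p (ball x₀ r) u (5 * ‖h‖) (a • x + b) +
          Phi p (ball x₀ r) u (5 * ‖h‖) (a • x + (b + (2:ℝ) • h))) := by
  set Ω := ball x₀ r with hΩ
  set t := ‖h‖ with ht
  by_cases hm : (x, x + h) ∈ Ω ×ˢ Ω
  swap
  · unfold gg; rw [Set.indicator_of_notMem hm]; exact zero_le
  obtain ⟨hx, hxh⟩ := hm
  simp only at hx hxh
  set x' := a • x + b with hx'
  set y' := x' + (2:ℝ) • h with hy'
  have hay : a • x + (b + (2:ℝ) • h) = y' := by rw [hy', hx', add_assoc]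
  rw [hay]
  have htr : 2 * t / r < 1 / 2 := by
    rw [div_lt_iff₀ hr]; nlinarith
  have htr0 : 0 < 2 * t / r := by positivity
  have ha2 : 1 / 2 < a := by rw [ha]; linarith
  have har : a * r + 2 * t = r := by rw [ha]; field_simp; ring
  have hxn : ‖x - x₀‖ < r := by rw [← dist_eq_norm]; exact hx
  have hx'0 : ‖x' - x₀‖ < a * r := by
    have : x' - x₀ = a • (x - x₀) := by
      rw [hx', hb, ha]; module
    rw [this, norm_smul, Real.norm_of_nonneg (by linarith)]
    exact mul_lt_mul_of_pos_left hxn (by linarith)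
  have h2n : ‖(2:ℝ) • h‖ = 2 * t := by
    rw [norm_smul, Real.norm_of_nonneg (by norm_num)]
  have hxx' : ‖x' - x‖ ≤ 2 * t := by
    have : x' - x = -((2 * t / r) • (x - x₀)) := by
      rw [hx', hb, ha]; module
    rw [this, norm_neg, norm_smul, Real.norm_of_nonneg htr0.le]
    calc 2 * t / r * ‖x - x₀‖ ≤ 2 * t / r * r := by gcongr
      _ = 2 * t := by field_simp
  have hball : ball x' (2 * t) ⊆ Ω := by
    intro w hw
    rw [hΩ, mem_ball, dist_eq_norm]
    rw [mem_ball, dist_eq_norm] at hw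
    calc ‖w - x₀‖ = ‖(w - x') + (x' - x₀)‖ := by congr 1; abel
      _ ≤ ‖w - x'‖ + ‖x' - x₀‖ := norm_add_le _ _
      _ < r := by linarith
  have hx'Ω : x' ∈ Ω := hball (mem_ball_self (by positivity))
  have hy'Ω : y' ∈ Ω := by
    rw [hΩ, mem_ball, dist_eq_norm]
    calc ‖y' - x₀‖ = ‖(x' - x₀) + (2:ℝ) • h‖ := by congr 1; rw [hy']; abel
      _ ≤ ‖x' - x₀‖ + ‖(2:ℝ) • h‖ := norm_add_le _ _
      _ < r := by linarith
  set c : Fin 4 → ℝ := ![-1, 1, 1/2, -1/2] with hc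
  set z : Fin 4 → EuclideanSpace ℝ (Fin d) := ![x, x + h, x', y'] with hz
  have key := avg_bound p hp Ω u hu c z (by simp [hc, Fin.sum_univ_four]; norm_num)
    (by intro j; fin_cases j <;> simp [hc] <;> norm_num [abs_le])
    (by simp only [hc, hz, Fin.sum_univ_four, hy']; simp; module)
    t h0 x' hball
    (by intro j; fin_cases j <;> simp [hz] <;> assumption)
    (by
      intro j w hw
      rw [mem_ball, dist_eq_norm] at hw
      have hwx : ‖w - x‖ ≤ 4 * t := by
        calc ‖w - x‖ = ‖(w - x') + (x' - x)‖ := by congr 1; abel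
          _ ≤ ‖w - x'‖ + ‖x' - x‖ := norm_add_le _ _
          _ ≤ _ := by linarith
      have hwxh : ‖w - (x + h)‖ ≤ 5 * t := by
        calc ‖w - (x + h)‖ = ‖(w - x) - h‖ := by congr 1; abel
          _ ≤ ‖w - x‖ + ‖h‖ := norm_sub_le _ _
          _ ≤ _ := by linarith
      have hwy : ‖w - y'‖ ≤ 5 * t := by
        calc ‖w - y'‖ = ‖(w - x') - (2:ℝ) • h‖ := by congr 1; rw [hy']; abel
          _ ≤ ‖w - x'‖ + ‖(2:ℝ) • h‖ := norm_sub_le _ _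
          _ ≤ _ := by linarith
      have hwx2 : ‖w - x‖ ≤ 5 * t := by linarith
      have hwx' : ‖w - x'‖ ≤ 5 * t := by linarith
      fin_cases j <;> simp [hz] <;> assumption)
  have hT : ∑ j, c j • u (z j) = (u (x + h) - u x) - (1/2 : ℝ) • (u y' - u x') := by
    simp only [hc, hz, Fin.sum_univ_four]; simp; module
  have hPs : ∑ j, Phi p Ω u (5 * t) (z j) = Phi p Ω u (5 * t) x + Phi p Ω u (5 * t) (x + h) +
      Phi p Ω u (5 * t) x' + Phi p Ω u (5 * t) y' := by
    simp [hz, Fin.sum_univ_four]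
  rw [hT, hPs] at key
  set T := (u (x + h) - u x) - (1/2 : ℝ) • (u y' - u x') with hTdef
  have hnorm : ‖u x - u (x + h)‖ ≤ 2⁻¹ * ‖u x' - u y'‖ + ‖T‖ := by
    have : u x - u (x + h) = (1/2:ℝ) • (u x' - u y') - T := by rw [hTdef]; module
    rw [this]
    refine (norm_sub_le _ _).trans ?_
    rw [norm_smul, Real.norm_of_nonneg (by norm_num)]; norm_num
  have hreal : ‖u x - u (x + h)‖ ^ p ≤ (1 + δ) ^ p * 2 ^ (-p) * ‖u x' - u y'‖ ^ p +
      (1 + 1 / δ) ^ p * ‖T‖ ^ p := by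
    refine (Real.rpow_le_rpow (norm_nonneg _) hnorm (by linarith)).trans ?_
    refine (add_rpow_split p δ _ _ (by linarith) hδ (by positivity) (norm_nonneg _)).trans
      (le_of_eq ?_)
    rw [Real.mul_rpow (by norm_num) (norm_nonneg _), Real.inv_rpow (by norm_num),
      Real.rpow_neg (by norm_num)]
    ring
  unfold gg
  rw [Set.indicator_of_mem (show (x, x + h) ∈ Ω ×ˢ Ω from ⟨hx, hxh⟩),
    Set.indicator_of_mem (show (x', y') ∈ Ω ×ˢ Ω from ⟨hx'Ω, hy'Ω⟩)]
  simp only [Function.uncurry]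
  refine (ENNReal.ofReal_le_ofReal hreal).trans ?_
  rw [ENNReal.ofReal_add (by positivity) (by positivity), ENNReal.ofReal_mul (by positivity),
    ENNReal.ofReal_mul (p := (1 + 1 / δ) ^ p) (by positivity)]
  refine add_le_add le_rfl ?_
  unfold KK
  refine (mul_le_mul' le_rfl key).trans (le_of_eq ?_)
  ring

lemma step {d : ℕ} (p δ : ℝ) (hp : 1 < p) (hδ : 0 < δ) (hδ4 : δ ≤ 1 / 4)
    (x₀ : EuclideanSpace ℝ (Fin d)) (r : ℝ) (hr : 0 < r)
    (u : EuclideanSpace ℝ (Fin d) → EuclideanSpace ℝ (Fin d)) (hu : Measurable u)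
    (h : EuclideanSpace ℝ (Fin d)) (h0 : 0 < ‖h‖) (h1 : ‖h‖ < δ * r) :
    ∫⁻ x, gg p (ball x₀ r) u (x, x + h) ≤
      (ENNReal.ofReal ((1 + δ) ^ p * 2 ^ (-p)) * ENNReal.ofReal (((1 - 2 * δ) ^ d)⁻¹)) *
        (∫⁻ x, gg p (ball x₀ r) u (x, x + (2:ℝ) • h)) +
      (KK d p δ * (2 + 2 * ENNReal.ofReal (((1 - 2 * δ) ^ d)⁻¹))) *
        (wt d h * ∫⁻ k in closedBall 0 (5 * ‖h‖), ∫⁻ x, kk p (ball x₀ r) u (x, x + k)) := by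
  set Ω := ball x₀ r with hΩ
  have hΩm : MeasurableSet Ω := measurableSet_ball
  set a := 1 - 2 * ‖h‖ / r with ha
  set b := (2 * ‖h‖ / r) • x₀ with hb
  have hlt : 1 - 2 * δ ≤ a := by
    have : 2 * ‖h‖ / r ≤ 2 * δ := by rw [div_le_iff₀ hr]; nlinarith
    linarith
  have hδ1 : 0 < 1 - 2 * δ := by linarith
  have ha0 : 0 < a := by linarith
  have hJ : ENNReal.ofReal ((a ^ d)⁻¹) ≤ ENNReal.ofReal (((1 - 2 * δ) ^ d)⁻¹) := by
    apply ENNReal.ofReal_le_ofReal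
    gcongr
  have hPm := measurable_Phi p Ω hΩm u hu (5 * ‖h‖)
  have hgm := measurable_gg p Ω hΩm u hu
  set P := ∫⁻ z, Phi p Ω u (5 * ‖h‖) z with hP
  have hPe : P = ∫⁻ k in closedBall 0 (5 * ‖h‖), ∫⁻ x, kk p Ω u (x, x + k) :=
    lintegral_Phi p Ω hΩm u hu _
  rw [← hPe]
  have hg2 : Measurable fun x => gg p Ω u (x, x + (2:ℝ) • h) := hgm.comp (by fun_prop)
  have m0 : Measurable fun x => gg p Ω u (a • x + b, a • x + b + (2:ℝ) • h) :=
    hgm.comp (by fun_prop)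
  have m1 : Measurable fun x => Phi p Ω u (5 * ‖h‖) (x + h) := hPm.comp (by fun_prop)
  have m2 : Measurable fun x => Phi p Ω u (5 * ‖h‖) (a • x + b) := hPm.comp (by fun_prop)
  have m3 : Measurable fun x => Phi p Ω u (5 * ‖h‖) (a • x + (b + (2:ℝ) • h)) :=
    hPm.comp (by fun_prop)
  calc _ ≤ ∫⁻ x, (ENNReal.ofReal ((1 + δ) ^ p * 2 ^ (-p)) *
            gg p Ω u (a • x + b, a • x + b + (2:ℝ) • h) +
          KK d p δ * ENNReal.ofReal (‖h‖ ^ (-(d:ℝ))) *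
            (Phi p Ω u (5 * ‖h‖) x + Phi p Ω u (5 * ‖h‖) (x + h) +
              Phi p Ω u (5 * ‖h‖) (a • x + b) +
              Phi p Ω u (5 * ‖h‖) (a • x + (b + (2:ℝ) • h)))) := lintegral_mono (fun x =>
        pointwise_step p δ hp hδ hδ4 x₀ r hr u hu h h0 h1 x a ha b hb)
    _ = ENNReal.ofReal ((1 + δ) ^ p * 2 ^ (-p)) *
          (ENNReal.ofReal ((a ^ d)⁻¹) * ∫⁻ x, gg p Ω u (x, x + (2:ℝ) • h)) +
        KK d p δ * ENNReal.ofReal (‖h‖ ^ (-(d:ℝ))) *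
          (P + P + ENNReal.ofReal ((a ^ d)⁻¹) * P + ENNReal.ofReal ((a ^ d)⁻¹) * P) := by
        rw [lintegral_add_left (m0.const_mul _), lintegral_const_mul _ m0,
          lintegral_const_mul _ (show Measurable (fun x => Phi p Ω u (5 * ‖h‖) x +
            Phi p Ω u (5 * ‖h‖) (x + h) + Phi p Ω u (5 * ‖h‖) (a • x + b) +
            Phi p Ω u (5 * ‖h‖) (a • x + (b + (2:ℝ) • h))) from ((hPm.add m1).add m2).add m3),
          lintegral_add_right _ m3, lintegral_add_right _ m2, lintegral_add_right _ m1,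
          lintegral_affine _ hPm a ha0, lintegral_affine _ hPm a ha0,
          lintegral_add_right_eq_self (Phi p Ω u (5 * ‖h‖)) h,
          lintegral_affine (fun x => gg p Ω u (x, x + (2:ℝ) • h)) hg2 a ha0 b]
    _ ≤ ENNReal.ofReal ((1 + δ) ^ p * 2 ^ (-p)) *
          (ENNReal.ofReal (((1 - 2 * δ) ^ d)⁻¹) * ∫⁻ x, gg p Ω u (x, x + (2:ℝ) • h)) +
        KK d p δ * ENNReal.ofReal (‖h‖ ^ (-(d:ℝ))) *
          (P + P + ENNReal.ofReal (((1 - 2 * δ) ^ d)⁻¹) * P +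
            ENNReal.ofReal (((1 - 2 * δ) ^ d)⁻¹) * P) := by gcongr
    _ = _ := by unfold wt; ring

lemma choose_delta (d : ℕ) (s p : ℝ) (hs1 : s < 1) (hp : 1 < p) :
    ∃ δ : ℝ, 0 < δ ∧ δ ≤ 1 / 4 ∧
      (1 + δ) ^ p * 2 ^ (-p) * ((1 - 2 * δ) ^ d)⁻¹ * 2 ^ (s * p) < 1 := by
  set f : ℝ → ℝ := fun δ => (1 + δ) ^ p * 2 ^ (-p) * ((1 - 2 * δ) ^ d)⁻¹ * 2 ^ (s * p) with hf
  have hc : ContinuousAt f 0 := by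
    have h1 : ContinuousAt (fun δ : ℝ => (1 + δ) ^ p) 0 :=
      ContinuousAt.rpow_const (by fun_prop) (Or.inr (by linarith))
    have h2 : ContinuousAt (fun δ : ℝ => ((1 - 2 * δ) ^ d)⁻¹) 0 :=
      ContinuousAt.inv₀ (by fun_prop) (by simp)
    exact ((h1.mul continuousAt_const).mul h2).mul continuousAt_const
  have h0 : f 0 < 1 := by
    simp only [hf]
    simp only [add_zero, Real.one_rpow, one_mul, mul_zero, sub_zero, one_pow, inv_one, mul_one]
    rw [← Real.rpow_add (by norm_num)]
    apply Real.rpow_lt_one_of_one_lt_of_neg (by norm_num)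
    nlinarith
  have hev := hc.eventually (gt_mem_nhds h0)
  obtain ⟨ε, hε, hb⟩ := Metric.eventually_nhds_iff.mp hev
  refine ⟨min (ε / 2) (1 / 4), by positivity, min_le_right _ _, ?_⟩
  apply hb
  rw [Real.dist_eq, sub_zero, abs_of_pos (by positivity)]
  exact (min_le_left _ _).trans_lt (by linarith)

lemma total_bound {d : ℕ} (p : ℝ) (hp : 1 < p) (Ω : Set (EuclideanSpace ℝ (Fin d)))
    (hΩ : MeasurableSet Ω)
    (u : EuclideanSpace ℝ (Fin d) → EuclideanSpace ℝ (Fin d)) (hu : Measurable u) :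
    ∫⁻ h, ∫⁻ x, gg p Ω u (x, x + h) ≤
      ENNReal.ofReal (2 ^ p) * (2 * (volume Ω * lpP d p Ω u)) := by
  have h1 := shear Ω hΩ _ (measurable_diff p u hu) (fun _ => 1) measurable_const
  simp only [mul_one] at h1
  unfold gg
  rw [← h1]
  have hm : Measurable fun x => ENNReal.ofReal (‖u x‖ ^ p) := (hu.norm.pow_const p).ennreal_ofReal
  calc _ ≤ ∫⁻ x in Ω, ∫⁻ y in Ω, ENNReal.ofReal (2 ^ p) *
        (ENNReal.ofReal (‖u x‖ ^ p) + ENNReal.ofReal (‖u y‖ ^ p)) := by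
        apply lintegral_mono; intro x
        apply lintegral_mono; intro y
        beta_reduce
        rw [← ENNReal.ofReal_add (by positivity) (by positivity), ← ENNReal.ofReal_mul (by positivity)]
        apply ENNReal.ofReal_le_ofReal
        refine (Real.rpow_le_rpow (norm_nonneg _) (norm_sub_le _ _) (by linarith)).trans ?_
        refine (add_rpow_split p 1 _ _ (by linarith) one_pos (norm_nonneg _) (norm_nonneg _)).trans
          (le_of_eq ?_)
        norm_num; ring
    _ = _ := by
        have e : ∀ x, ∫⁻ y in Ω, ENNReal.ofReal (2 ^ p) *
            (ENNReal.ofReal (‖u x‖ ^ p) + ENNReal.ofReal (‖u y‖ ^ p)) =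
            ENNReal.ofReal (2 ^ p) * (ENNReal.ofReal (‖u x‖ ^ p) * volume Ω + lpP d p Ω u) := by
          intro x
          rw [lintegral_const_mul _ (hm.const_add _), lintegral_add_right _ hm, setLIntegral_const]
          rfl
        simp_rw [e]
        rw [lintegral_const_mul _ ((hm.mul_const _).add_const _),
          lintegral_add_right _ measurable_const, lintegral_mul_const _ hm, setLIntegral_const]
        change _ * (lpP d p Ω u * _ + _) = _
        ring

end KornAux

open KornAux

/-- **Corollary 3.4 (fractional Korn's inequality on balls, with scaling).**
Let `d ≥ 2`, `s ∈ (0,1)`, `p ∈ (1,∞)` with `s p ≠ 1`.  There is `C = C(d,s,p)` such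
that for every ball `B_r(x₀)` and every `u ∈ [C¹_c(B_r(x₀))]^d`,
`∫∫ |u x - u y|^p/|x-y|^{d+sp} ≤ C ∫∫ |(u x - u y)⬝(x-y)/|x-y||^p/|x-y|^{d+sp}
  + (C/r^{sp}) ∫ |u|^p`. -/
theorem fractional_korn_inequality_ball
    (d : ℕ) (hd : 2 ≤ d) (s p : ℝ) (hs0 : 0 < s) (hs1 : s < 1) (hp : 1 < p)
    (hsp : s * p ≠ 1) :
    ∃ C > (0 : ℝ), ∀ (r : ℝ), 0 < r → ∀ (x₀ : EuclideanSpace ℝ (Fin d))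
      (u : EuclideanSpace ℝ (Fin d) → EuclideanSpace ℝ (Fin d)),
      C1c d (Metric.ball x₀ r) u →
        gagliardoP d s p (Metric.ball x₀ r) u ≤
          ENNReal.ofReal C * projP d s p (Metric.ball x₀ r) u +
            ENNReal.ofReal (C / r ^ (s * p)) * lpP d p (Metric.ball x₀ r) u := by
  obtain ⟨δ, hδ, hδ4, hθ⟩ := choose_delta d s p hs1 hp
  have hσ : 0 < s * p := by positivity
  obtain ⟨CT, hCT, habs⟩ := absorb (d := d) (s * p) hσ
  set V := volume (ball (0 : EuclideanSpace ℝ (Fin d)) 1) with hV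
  have hV0 : V ≠ 0 := (measure_ball_pos _ _ one_pos).ne'
  have hVt : V ≠ ⊤ := measure_ball_lt_top.ne
  set J := ENNReal.ofReal (((1 - 2 * δ) ^ d)⁻¹) with hJ
  set c := ENNReal.ofReal ((1 + δ) ^ p * 2 ^ (-p)) * J with hc
  set K := KK d p δ * (2 + 2 * J) with hK
  set θ := c * ENNReal.ofReal (2 ^ (s * p)) with hθd
  have hθ1 : θ < 1 := by
    have hδ1 : 0 < 1 - 2 * δ := by linarith
    rw [hθd, hc, hJ, ← ENNReal.ofReal_mul (by positivity), ← ENNReal.ofReal_mul (by positivity)]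
    rw [ENNReal.ofReal_lt_one]
    exact hθ
  have hKt : K ≠ ⊤ := by
    have h1 : KK d p δ ≠ ⊤ := by
      unfold KK
      exact ENNReal.mul_ne_top ENNReal.ofReal_ne_top
        (ENNReal.mul_ne_top (ENNReal.mul_ne_top ENNReal.ofReal_ne_top (by norm_num))
          (ENNReal.inv_ne_top.mpr hV0))
    exact ENNReal.mul_ne_top h1 (ENNReal.add_ne_top.mpr ⟨by norm_num,
      ENNReal.mul_ne_top (by norm_num) ENNReal.ofReal_ne_top⟩)
  have hI : (1 - θ)⁻¹ ≠ ⊤ := ENNReal.inv_ne_top.mpr (tsub_pos_of_lt hθ1).ne'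
  set C1 := (1 - θ)⁻¹ * (K * CT) with hC1
  set C2 := (1 - θ)⁻¹ * (ENNReal.ofReal (δ ^ (-(d + s * p))) * (ENNReal.ofReal (2 ^ p) * (2 * V)))
    with hC2
  have hC1t : C1 ≠ ⊤ := ENNReal.mul_ne_top hI (ENNReal.mul_ne_top hKt hCT)
  have hC2t : C2 ≠ ⊤ := ENNReal.mul_ne_top hI (ENNReal.mul_ne_top ENNReal.ofReal_ne_top
    (ENNReal.mul_ne_top ENNReal.ofReal_ne_top (ENNReal.mul_ne_top (by norm_num) hVt)))
  refine ⟨C1.toReal + C2.toReal + 1, by positivity, ?_⟩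
  intro r hr x₀ u hu
  set C := C1.toReal + C2.toReal + 1 with hC
  have hC1C : C1 ≤ ENNReal.ofReal C := by
    rw [← ENNReal.ofReal_toReal hC1t]
    apply ENNReal.ofReal_le_ofReal
    have := ENNReal.toReal_nonneg (a := C2)
    linarith
  have hC2C : C2 ≤ ENNReal.ofReal C := by
    rw [← ENNReal.ofReal_toReal hC2t]
    apply ENNReal.ofReal_le_ofReal
    have := ENNReal.toReal_nonneg (a := C1)
    linarith
  have hCpos : 0 < C := by positivity
  have hum : Measurable u := hu.1.continuous.measurable
  set Ω := ball x₀ r with hΩ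
  have hΩm : MeasurableSet Ω := measurableSet_ball
  by_cases hL : lpP d p Ω u = ⊤
  · rw [hL, ENNReal.mul_top]
    · simp
    · rw [Ne, ENNReal.ofReal_eq_zero, not_le]; positivity
  have hvol : volume Ω = ENNReal.ofReal (r ^ d) * V := by
    rw [hΩ, Measure.addHaar_ball_of_pos _ _ hr, finrank_euclideanSpace_fin]
  set A : EuclideanSpace ℝ (Fin d) → ℝ≥0∞ := fun h => ∫⁻ x, gg p Ω u (x, x + h) with hA
  set B : EuclideanSpace ℝ (Fin d) → ℝ≥0∞ := fun h => ∫⁻ x, kk p Ω u (x, x + h) with hB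
  have hdiv : ∀ (a : ℝ) (x y : EuclideanSpace ℝ (Fin d)), 0 ≤ a →
      ENNReal.ofReal (a / ‖x - y‖ ^ ((d : ℝ) + s * p)) =
        ENNReal.ofReal a * wt (d + s * p) (y - x) := by
    intro a x y ha
    unfold wt
    rw [← ENNReal.ofReal_mul ha, Real.rpow_neg (norm_nonneg _), norm_sub_rev y x, div_eq_mul_inv]
  have hGA : gagliardoP d s p Ω u = ∫⁻ h, A h * wt (d + s * p) h := by
    have := shear Ω hΩm _ (measurable_diff p u hum) (wt (d + s * p)) (measurable_wt _)
    rw [hA]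
    unfold gg
    rw [← this]
    unfold gagliardoP
    simp_rw [fun x y => hdiv (‖u x - u y‖ ^ p) x y (by positivity)]
  have hPB : projP d s p Ω u = ∫⁻ h, B h * wt (d + s * p) h := by
    have := shear Ω hΩm _ (measurable_pr p u hum) (wt (d + s * p)) (measurable_wt _)
    rw [hB]
    unfold kk
    rw [← this]
    unfold projP
    simp_rw [fun x y => hdiv ((|(⟪u x - u y, x - y⟫) / ‖x - y‖|) ^ p) x y (by positivity)]
    rfl
  have hp0 : p ≠ 0 := by linarith
  have hA0 : A 0 = 0 := by
    simp [hA, gg, Set.indicator, hp0]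
  have hB0 : B 0 = 0 := by
    simp [hB, kk, pr, Set.indicator, hp0]
  have hAm : Measurable A := by
    apply Measurable.lintegral_prod_right'
      (f := fun a : EuclideanSpace ℝ (Fin d) × EuclideanSpace ℝ (Fin d) => gg p Ω u (a.2, a.2 + a.1))
    exact (measurable_gg p Ω hΩm u hum).comp (by fun_prop)
  have hBm : Measurable B := by
    apply Measurable.lintegral_prod_right'
      (f := fun a : EuclideanSpace ℝ (Fin d) × EuclideanSpace ℝ (Fin d) => kk p Ω u (a.2, a.2 + a.1))
    exact (measurable_kk p Ω hΩm u hum).comp (by fun_prop)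
  have htot := total_bound p hp Ω hΩm u hum
  have hAt : ∫⁻ h, A h ≠ ⊤ := by
    refine ne_top_of_le_ne_top ?_ htot
    exact ENNReal.mul_ne_top ENNReal.ofReal_ne_top (ENNReal.mul_ne_top (by norm_num)
      (ENNReal.mul_ne_top measure_ball_lt_top.ne hL))
  have hmain := habs A B hAm hBm hA0 hB0 (δ * r) c K θ (by positivity) le_rfl hθ1
    (fun h h0 h1 => step p δ hp hδ hδ4 x₀ r hr u hum h h0 h1) hAt
  rw [← hGA, ← hPB] at hmain
  have hpow : ENNReal.ofReal ((δ * r) ^ (-(d + s * p))) * ENNReal.ofReal (r ^ d) =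
      ENNReal.ofReal (δ ^ (-(d + s * p))) * ENNReal.ofReal ((r ^ (s * p))⁻¹) := by
    rw [← ENNReal.ofReal_mul (by positivity), ← ENNReal.ofReal_mul (by positivity),
      Real.mul_rpow hδ.le hr.le, mul_assoc, ← Real.rpow_natCast r d, ← Real.rpow_add hr,
      ← Real.rpow_neg hr.le]
    congr 3
    ring
  calc gagliardoP d s p Ω u ≤ _ := hmain
    _ ≤ (1 - θ)⁻¹ * (K * (CT * projP d s p Ω u) + ENNReal.ofReal ((δ * r) ^ (-(d + s * p))) *
          (ENNReal.ofReal (2 ^ p) * (2 * (volume Ω * lpP d p Ω u)))) := by gcongr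
    _ = C1 * projP d s p Ω u + (1 - θ)⁻¹ * ((ENNReal.ofReal ((δ * r) ^ (-(d + s * p))) *
          ENNReal.ofReal (r ^ d)) * (ENNReal.ofReal (2 ^ p) * (2 * V))) * lpP d p Ω u := by
        rw [hvol, hC1]; ring
    _ = C1 * projP d s p Ω u + C2 * ENNReal.ofReal ((r ^ (s * p))⁻¹) * lpP d p Ω u := by
        rw [hpow, hC2]; ring
    _ ≤ ENNReal.ofReal C * projP d s p Ω u +
          ENNReal.ofReal C * ENNReal.ofReal ((r ^ (s * p))⁻¹) * lpP d p Ω u := by gcongr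
    _ = _ := by rw [← ENNReal.ofReal_mul hCpos.le, div_eq_mul_inv]
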